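/- arXiv:2204.01317 — 5 statements merged into one kernel-verified Lean document; each statement's English description precedes it below -/
import Mathlib

section
/- Every R-module homomorphism φ : ω → R is given by multiplication (inside the Laurent polynomial ring k[ℤ^n]) by a unique element of the k-vector space spanned by the monomials χ^{m'} with m' ∈ P_{−K} ∩ M; conversely, multiplication by any element of that span maps ω into R. Hence Hom_R(ω, R) is isomorphic as an R-module to the R-submodule of k[ℤ^n] spanned by the monomials χ^{m'}, m' ∈ P_{−K} ∩ M. -/
set_option synthInstance.maxHeartbeats 1000000
set_option maxHeartbeats 1000000

noncomputable section

variable {α : Type} [Fintype α]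

/-- pairing of an integer vector with a real vector -/
def ipair (u : α → ℤ) (x : α → ℝ) : ℝ := ∑ j, (u j : ℝ) * x j

/-- pairing of two integer vectors -/
def zpair (u m : α → ℤ) : ℤ := ∑ j, u j * m j

/-- pairing of two real vectors -/
def rpair (u x : α → ℝ) : ℝ := ∑ j, u j * x j

/-- the real vector associated to an integer vector -/
def toReal (m : α → ℤ) : α → ℝ := fun j => (m j : ℝ)

variable {ι : Type} [Fintype ι]

/-- the cone `σ` generated by the integer vectors `u i` -/
def genCone (u : ι → α → ℤ) : Set (α → ℝ) :=
  {x | ∃ c : ι → ℝ, (∀ i, 0 ≤ c i) ∧ x = ∑ i, c i • toReal (u i)}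

/-- the dual cone `σ^∨` of the cone generated by the `u i` -/
def dualCone (u : ι → α → ℤ) : Set (α → ℝ) := {x | ∀ i, 0 ≤ ipair (u i) x}

/-- the polyhedron `P_K` -/
def PK (u : ι → α → ℤ) : Set (α → ℝ) := {x | ∀ i, 1 ≤ ipair (u i) x}

/-- the polyhedron `P_{-K}` -/
def PmK (u : ι → α → ℤ) : Set (α → ℝ) := {x | ∀ i, (-1 : ℝ) ≤ ipair (u i) x}

/-- the cone generated by `u` is pointed -/
def IsPointed (u : ι → α → ℤ) : Prop := ∀ x ∈ genCone u, -x ∈ genCone u → x = 0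

/-- an integer vector is primitive if the gcd of its coordinates is a unit -/
def Primitive (m : α → ℤ) : Prop := IsUnit (Finset.univ.gcd m)

/-- the ray spanned by an integer vector -/
def ray (v : α → ℤ) : Set (α → ℝ) := {x | ∃ t : ℝ, 0 ≤ t ∧ x = t • toReal v}

/-- `u` lists exactly the primitive ray generators of the rational pointed cone `σ` that it
generates: `σ` is pointed, each `u i` is primitive, and each `u i` spans an extreme ray of `σ`. -/
def IsRaySetup (u : ι → α → ℤ) : Prop :=
  IsPointed u ∧ (∀ i, Primitive (u i)) ∧ ∀ i, IsExtreme ℝ (genCone u) (ray (u i))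

variable (k : Type) [Field k]

/-- the monomial `χ^m` in the Laurent polynomial ring `k[ℤ^α]` -/
def mono (m : α → ℤ) : AddMonoidAlgebra k (α → ℤ) := AddMonoidAlgebra.single m 1

/-- the toric ring `R = k[σ^∨ ∩ M]`, the subalgebra of `k[ℤ^α]` spanned by the monomials
`χ^m` with `m ∈ σ^∨ ∩ M` -/
def toricRing (u : ι → α → ℤ) : Subalgebra k (AddMonoidAlgebra k (α → ℤ)) :=
  Algebra.adjoin k {f | ∃ m : α → ℤ, toReal m ∈ dualCone u ∧ f = mono k m}

/-- the canonical module `ω`, the `R`-submodule of `k[ℤ^α]` spanned by the monomials `χ^m`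
with `m ∈ P_K ∩ M` -/
def canMod (u : ι → α → ℤ) : Submodule ↥(toricRing k u) (AddMonoidAlgebra k (α → ℤ)) :=
  Submodule.span ↥(toricRing k u) {f | ∃ m : α → ℤ, toReal m ∈ PK u ∧ f = mono k m}

/-- the trace ideal `tr(ω)` of the canonical module -/
def traceIdeal (u : ι → α → ℤ) : Ideal ↥(toricRing k u) :=
  Ideal.span {r | ∃ (φ : ↥(canMod k u) →ₗ[↥(toricRing k u)] ↥(toricRing k u))
    (x : ↥(canMod k u)), φ x = r}

/-- a face `F` of the dual cone `σ^∨`: the intersection of `σ^∨` with the hyperplane orthogonal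
to a supporting vector `w ∈ σ` -/
def IsFaceOfDual (u : ι → α → ℤ) (F : Set (α → ℝ)) : Prop :=
  ∃ w ∈ genCone u, F = {x ∈ dualCone u | rpair w x = 0}

/-- the graded prime ideal `p_F` associated to a face `F` of `σ^∨`, generated by the monomials
`χ^m` with `m ∈ (σ^∨ ∩ M) \ F` -/
def facePrime (u : ι → α → ℤ) (F : Set (α → ℝ)) : Ideal ↥(toricRing k u) :=
  Ideal.span {r | ∃ m : α → ℤ, toReal m ∈ dualCone u ∧ toReal m ∉ F ∧
    (r : AddMonoidAlgebra k (α → ℤ)) = mono k m}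

/-- `F[1]`: the intersection of all facet-defining hyperplanes containing `F`, translated by one
lattice length into the interior of `σ^∨` -/
def faceShift (u : ι → α → ℤ) (F : Set (α → ℝ)) : Set (α → ℝ) :=
  {x | ∀ i, (∀ y ∈ F, ipair (u i) y = 0) → ipair (u i) x = 1}

end

/-- **Gordan's theorem** over an ordered field: finitely many vectors without a nontrivial
nonnegative linear relation are all positive under some linear functional. -/
theorem exists_dual_pos_of_forall_nonneg_relation {K ι : Type*} [Field K] [LinearOrder K]
    [IsStrictOrderedRing K] (s : Finset ι) {E : Type*} [AddCommGroup E] [Module K E] (v : ι → E)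
    (hv : ∀ c : ι → K, (∀ i ∈ s, 0 ≤ c i) → ∑ i ∈ s, c i • v i = 0 → ∀ i ∈ s, c i = 0) :
    ∃ f : Module.Dual K E, ∀ i ∈ s, 0 < f (v i) := by
  classical
  induction s using Finset.induction_on generalizing E with
  | empty => exact ⟨0, by simp⟩
  | insert a s ha ih =>
    have sum_update (c : ι → K) (t : K) :
        ∑ i ∈ s, Function.update c a t i • v i = ∑ i ∈ s, c i • v i :=
      Finset.sum_congr rfl fun i hi => by
        rw [Function.update_of_ne (ne_of_mem_of_not_mem hi ha)]
    have nonneg_update (c : ι → K) (hc : ∀ i ∈ s, 0 ≤ c i) (t : K) (ht : 0 ≤ t) :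
        ∀ i ∈ insert a s, 0 ≤ Function.update c a t i := by
      intro i hi
      rcases eq_or_ne i a with rfl | h
      · simpa using ht
      · rw [Function.update_of_ne h]
        exact hc i (Finset.mem_of_mem_insert_of_ne hi h)
    by_cases h : ∀ c : ι → K, (∀ i ∈ s, 0 ≤ c i) →
        ∑ i ∈ s, c i • (K ∙ v a).mkQ (v i) = 0 → ∀ i ∈ s, c i = 0
    · obtain ⟨f, hf⟩ := ih (fun i => (K ∙ v a).mkQ (v i)) h
      have hva : v a ≠ 0 := by
        intro h0
        have := hv (Function.update 0 a 1) (nonneg_update 0 (by simp) 1 zero_le_one)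
          (by rw [Finset.sum_insert ha, sum_update]; simp [h0]) a (Finset.mem_insert_self a s)
        simp at this
      obtain ⟨g, hg⟩ : ∃ g : Module.Dual K E, g (v a) ≠ 0 := by
        by_contra! h0
        exact hva ((Module.forall_dual_apply_eq_zero_iff K _).1 h0)
      set G : Module.Dual K E := (g (v a))⁻¹ • g with hG
      set F : Module.Dual K E := f.comp (K ∙ v a).mkQ with hF
      have hFa : F (v a) = 0 := by
        have : (K ∙ v a).mkQ (v a) = 0 := by simp
        rw [hF, LinearMap.comp_apply, this, map_zero]
      have hFs : ∀ i ∈ s, 0 < F (v i) := hf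
      set N : K := ∑ i ∈ s, |G (v i)| / F (v i) + 1 with hN
      refine ⟨N • F + G, fun i hi => ?_⟩
      rcases Finset.mem_insert.1 hi with rfl | hi
      · simp [hFa, hG, hg]
      · have h1 : |G (v i)| / F (v i) + 1 ≤ N := by
          rw [hN]
          gcongr
          exact Finset.single_le_sum (f := fun i => |G (v i)| / F (v i))
            (fun j hj => div_nonneg (abs_nonneg _) (hFs j hj).le) hi
        have h2 := mul_le_mul_of_nonneg_right h1 (hFs i hi).le
        rw [add_mul, div_mul_cancel₀ _ (hFs i hi).ne', one_mul] at h2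
        have h3 := neg_abs_le (G (v i))
        have h4 := hFs i hi
        simp only [LinearMap.add_apply, LinearMap.smul_apply, smul_eq_mul]
        linarith
    · push Not at h
      obtain ⟨c, hc, hsum, j, hj, hcj⟩ := h
      simp only [← map_smul, ← map_sum] at hsum
      rw [Submodule.mkQ_apply, Submodule.Quotient.mk_eq_zero,
        Submodule.mem_span_singleton] at hsum
      obtain ⟨t, ht⟩ := hsum
      have htpos : 0 < t := by
        by_contra! ht0
        have := hv (Function.update c a (-t)) (nonneg_update c hc _ (by linarith))
          (by rw [Finset.sum_insert ha, sum_update, ← ht]; simp) j (Finset.mem_insert_of_mem hj)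
        rw [Function.update_of_ne (ne_of_mem_of_not_mem hj ha)] at this
        exact hcj this
      obtain ⟨f, hf⟩ := ih v fun d hd hdsum i hi => by
        have := hv (Function.update d a 0) (nonneg_update d hd _ le_rfl)
          (by rw [Finset.sum_insert ha, sum_update, hdsum]; simp) i (Finset.mem_insert_of_mem hi)
        rwa [Function.update_of_ne (ne_of_mem_of_not_mem hi ha)] at this
      refine ⟨f, fun i hi => ?_⟩
      rcases Finset.mem_insert.1 hi with rfl | hi
      · have h1 : t * f (v i) = ∑ j ∈ s, c j * f (v j) := by
          simpa using congrArg f ht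
        have h2 : 0 < ∑ j ∈ s, c j * f (v j) :=
          Finset.sum_pos' (fun i hi => mul_nonneg (hc i hi) (hf i hi).le)
            ⟨j, hj, mul_pos ((hc j hj).lt_of_ne' hcj) (hf j hj)⟩
        exact pos_of_mul_pos_right (h1 ▸ h2) htpos.le
      · exact hf i hi

section GenCone

variable {α ι : Type} [Fintype ι] {u : ι → α → ℤ}

theorem sum_smul_mem_genCone (s : Finset ι) {c : ι → ℝ} (hc : ∀ i ∈ s, 0 ≤ c i) :
    ∑ i ∈ s, c i • toReal (u i) ∈ genCone u := by
  classical
  refine ⟨fun i => if i ∈ s then c i else 0, fun i => ?_, ?_⟩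
  · dsimp only
    split_ifs with h
    exacts [hc i h, le_rfl]
  · simp [ite_smul, Finset.sum_ite_mem]

theorem smul_mem_genCone (i : ι) {t : ℝ} (ht : 0 ≤ t) : t • toReal (u i) ∈ genCone u := by
  simpa using sum_smul_mem_genCone (u := u) {i} (c := fun _ => t) (by simpa using ht)

theorem add_mem_genCone {x y : α → ℝ} (hx : x ∈ genCone u) (hy : y ∈ genCone u) :
    x + y ∈ genCone u := by
  obtain ⟨c, hc, rfl⟩ := hx
  obtain ⟨d, hd, rfl⟩ := hy
  exact ⟨c + d, fun i => add_nonneg (hc i) (hd i), by simp [add_smul, Finset.sum_add_distrib]⟩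

theorem two_smul_mem_genCone {x : α → ℝ} (hx : x ∈ genCone u) : (2 : ℝ) • x ∈ genCone u := by
  rw [two_smul]
  exact add_mem_genCone hx hx

/-- A nonnegative combination of generators off an extreme ray lies on the line of that ray only
trivially. -/
theorem coeff_eq_zero_of_sum_eq_smul {i : ι} (hi : IsExtreme ℝ (genCone u) (ray (u i)))
    (s : Finset ι) (hs : ∀ j ∈ s, toReal (u j) ∉ ray (u i)) {c : ι → ℝ} (hc : ∀ j ∈ s, 0 ≤ c j)
    {t : ℝ} (ht : ∑ j ∈ s, c j • toReal (u j) = t • toReal (u i)) : ∀ j ∈ s, c j = 0 := by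
  classical
  intro j hj
  by_contra hne
  have hpos : 0 < c j := (hc j hj).lt_of_ne' hne
  obtain ⟨a, b, ha, hb, rfl⟩ : ∃ a b : ℝ, 0 ≤ a ∧ 0 ≤ b ∧ t = a - b := by
    rcases le_total 0 t with h | h
    · exact ⟨t, 0, h, le_rfl, by simp⟩
    · exact ⟨0, -t, le_rfl, by linarith, by simp⟩
  have hx : (2 : ℝ) • c j • toReal (u j) ∈ genCone u :=
    two_smul_mem_genCone (smul_mem_genCone j hpos.le)
  have hy : (2 : ℝ) • (∑ l ∈ s.erase j, c l • toReal (u l) + b • toReal (u i)) ∈ genCone u :=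
    two_smul_mem_genCone (add_mem_genCone
      (sum_smul_mem_genCone _ fun l hl => hc l (Finset.mem_of_mem_erase hl))
      (smul_mem_genCone i hb))
  have hz : a • toReal (u i) ∈ ray (u i) := ⟨a, ha, rfl⟩
  obtain ⟨r, hr, hrx⟩ := hi.left_mem_of_mem_openSegment hx hy hz
    ⟨1 / 2, 1 / 2, by norm_num, by norm_num, by norm_num, by
      rw [← Finset.add_sum_erase s _ hj, sub_smul, eq_sub_iff_add_eq] at ht
      rw [← ht]
      module⟩
  refine hs j hj ⟨(2 * c j)⁻¹ * r, by positivity, ?_⟩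
  rw [mul_smul, ← hrx, smul_smul, smul_smul, mul_assoc, inv_mul_cancel₀ (by positivity), one_smul]

end GenCone

section Cone

variable {α ι : Type} [Fintype α] [Fintype ι] {u : ι → α → ℤ}

theorem ipair_toReal (v m : α → ℤ) : ipair v (toReal m) = (zpair v m : ℝ) := by
  simp [ipair, zpair, toReal]

theorem zpair_add (v m m' : α → ℤ) : zpair v (m + m') = zpair v m + zpair v m' := by
  simp [zpair, mul_add, Finset.sum_add_distrib]

theorem zpair_smul (v m : α → ℤ) (c : ℤ) : zpair v (c • m) = c * zpair v m := by
  simp [zpair, Finset.mul_sum, mul_left_comm]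

theorem Primitive.exists_zpair_eq_one {v : α → ℤ} (hv : Primitive v) : ∃ m, zpair v m = 1 := by
  obtain ⟨f, hf⟩ := Finset.gcd_eq_sum_mul Finset.univ v
  obtain ⟨b, hb⟩ := isUnit_iff_exists_inv.1 hv
  refine ⟨b • f, ?_⟩
  rw [zpair_smul, ← hb, hf, mul_comm]
  rfl

/-- The linear span of an extreme ray is cut out of the cone by an integral supporting
hyperplane. -/
theorem exists_zpair_eq_zero_and_pos {i : ι} (hi : IsExtreme ℝ (genCone u) (ray (u i))) :
    ∃ w : α → ℤ, zpair (u i) w = 0 ∧ ∀ j, toReal (u j) ∉ ray (u i) → 0 < zpair (u j) w := by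
  classical
  let q : (α → ℤ) → α → ℚ := fun m j => (m j : ℚ)
  obtain ⟨f, hf⟩ := exists_dual_pos_of_forall_nonneg_relation (K := ℚ)
    (Finset.univ.filter fun j => toReal (u j) ∉ ray (u i))
    (fun j => (ℚ ∙ q (u i)).mkQ (q (u j))) (by
      intro c hc hsum j hj
      simp only [← map_smul, ← map_sum] at hsum
      rw [Submodule.mkQ_apply, Submodule.Quotient.mk_eq_zero,
        Submodule.mem_span_singleton] at hsum
      obtain ⟨t, ht⟩ := hsum
      have := coeff_eq_zero_of_sum_eq_smul hi _ (fun j hj => (Finset.mem_filter.1 hj).2)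
        (c := fun j => (c j : ℝ)) (t := t) (fun j hj => by exact_mod_cast hc j hj)
        (by
          ext l
          have := congrFun ht l
          simp only [Finset.sum_apply, Pi.smul_apply, smul_eq_mul, q, toReal] at this ⊢
          exact_mod_cast this.symm) j hj
      exact_mod_cast this)
  set F : Module.Dual ℚ (α → ℚ) := f.comp (ℚ ∙ q (u i)).mkQ with hF
  obtain ⟨b, hb⟩ := IsLocalization.exist_integer_multiples_of_finite (nonZeroDivisors ℤ)
    (fun j => F (Pi.single j 1))
  choose w hw using hb
  have hb0 : (b : ℤ) ≠ 0 := nonZeroDivisors.coe_ne_zero b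
  have key (m : α → ℤ) : (zpair m ((b : ℤ) • w) : ℚ) = (b : ℚ) ^ 2 * F (q m) := by
    rw [LinearMap.pi_apply_eq_sum_univ F (q m), zpair_smul]
    simp only [zpair, Int.cast_mul, Int.cast_sum, Finset.mul_sum, smul_eq_mul, q]
    refine Finset.sum_congr rfl fun j _ => ?_
    have h1 := hw j
    simp only [algebraMap_int_eq, eq_intCast, zsmul_eq_mul] at h1
    have h2 : (fun l => if j = l then (1 : ℚ) else 0) = Pi.single j 1 := by
      ext l
      simp [Pi.single_apply, eq_comm]
    rw [h1, h2]
    ring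
  refine ⟨(b : ℤ) • w, ?_, fun j hj => ?_⟩
  · have h0 : F (q (u i)) = 0 := by
      have : (ℚ ∙ q (u i)).mkQ (q (u i)) = 0 := by simp
      rw [hF, LinearMap.comp_apply, this, map_zero]
    have := key (u i)
    rw [h0, mul_zero] at this
    exact_mod_cast this
  · have h1 : 0 < F (q (u j)) := hf j (by simpa using hj)
    have h2 : (b : ℚ) ≠ 0 := by exact_mod_cast hb0
    have h3 : (0 : ℚ) < zpair (u j) ((b : ℤ) • w) := by
      rw [key]
      positivity
    exact_mod_cast h3

/-- Every facet inequality of `P_K` is attained with equality at a lattice point. -/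
theorem exists_zpair_eq_one_forall_one_le (hu : IsRaySetup u) (i : ι) :
    ∃ m : α → ℤ, zpair (u i) m = 1 ∧ ∀ j, 1 ≤ zpair (u j) m := by
  obtain ⟨-, hprim, hext⟩ := hu
  obtain ⟨m, hm⟩ := (hprim i).exists_zpair_eq_one
  obtain ⟨w, hw, hw'⟩ := exists_zpair_eq_zero_and_pos (hext i)
  set N : ℤ := ∑ j, |zpair (u j) m| + 1 with hN
  have hpair (j : ι) : zpair (u j) (m + N • w) = zpair (u j) m + N * zpair (u j) w := by
    rw [zpair_add, zpair_smul]
  refine ⟨m + N • w, by rw [hpair, hm, hw]; simp, fun j => ?_⟩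
  rw [hpair]
  by_cases hj : toReal (u j) ∈ ray (u i)
  · obtain ⟨t, ht, htu⟩ := hj
    have htpair (l : α → ℤ) : (zpair (u j) l : ℝ) = t * zpair (u i) l := by
      have h (a : α) : ((u j a : ℤ) : ℝ) = t * u i a := congrFun htu a
      simp only [zpair, Int.cast_sum, Int.cast_mul, Finset.mul_sum, h, mul_assoc]
    have hjw : zpair (u j) w = 0 := by
      have := htpair w
      rw [hw] at this
      simpa using this
    have hjm : (zpair (u j) m : ℝ) = t := by
      rw [htpair, hm]
      simp
    have ht0 : t ≠ 0 := by
      rintro rfl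
      obtain ⟨l, hl⟩ := (hprim j).exists_zpair_eq_one
      have := htpair l
      rw [hl] at this
      simp at this
    have hpos : (0 : ℝ) < zpair (u j) m := hjm ▸ ht.lt_of_ne' ht0
    have : 0 < zpair (u j) m := by exact_mod_cast hpos
    rw [hjw]
    omega
  · have h1 := hw' j hj
    have h2 : |zpair (u j) m| + 1 ≤ N := by
      rw [hN]
      gcongr
      exact Finset.single_le_sum (f := fun j => |zpair (u j) m|) (fun _ _ => abs_nonneg _)
        (Finset.mem_univ j)
    have h3 := neg_abs_le (zpair (u j) m)
    have h4 := abs_nonneg (zpair (u j) m)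
    nlinarith

theorem exists_forall_one_le_zpair (hu : IsRaySetup u) : ∃ m : α → ℤ, ∀ j, 1 ≤ zpair (u j) m := by
  rcases isEmpty_or_nonempty ι with h | ⟨⟨i⟩⟩
  · exact ⟨0, fun j => isEmptyElim j⟩
  · obtain ⟨m, -, hm⟩ := exists_zpair_eq_one_forall_one_le hu i
    exact ⟨m, hm⟩

end Cone

theorem mono_mul_mono_neg {α : Type} (k : Type) [Field k] (m : α → ℤ) :
    mono k m * mono k (-m) = 1 := by
  simp [mono, AddMonoidAlgebra.single_mul_single, AddMonoidAlgebra.one_def]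

section Module

variable {α ι : Type} [Fintype α] (u : ι → α → ℤ) (k : Type) [Field k]

/-- The Laurent polynomials supported on the lattice points at level at least `c` with respect to
every `u i`. -/
noncomputable def levelSubmodule (c : ℤ) : Submodule k (AddMonoidAlgebra k (α → ℤ)) :=
  AddMonoidAlgebra.supported k k {m | ∀ i, c ≤ zpair (u i) m}

variable {u k}

theorem mem_levelSubmodule {c : ℤ} {f : AddMonoidAlgebra k (α → ℤ)} :
    f ∈ levelSubmodule u k c ↔ ∀ m, f.coeff m ≠ 0 → ∀ i, c ≤ zpair (u i) m := by
  simp [levelSubmodule, AddMonoidAlgebra.mem_supported, Set.subset_def]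

theorem levelSubmodule_eq_span (c : ℤ) :
    levelSubmodule u k c = Submodule.span k {g | ∃ m, (∀ i, c ≤ zpair (u i) m) ∧ g = mono k m} := by
  rw [levelSubmodule, AddMonoidAlgebra.supported_eq_span_single]
  congr 1
  ext g
  simp [mono, eq_comm]

theorem mono_mem_levelSubmodule {c : ℤ} {m : α → ℤ} (hm : ∀ i, c ≤ zpair (u i) m) :
    mono k m ∈ levelSubmodule u k c := by
  rw [levelSubmodule_eq_span]
  exact Submodule.subset_span ⟨m, hm, rfl⟩

theorem mul_mem_levelSubmodule {a b : ℤ} {f g : AddMonoidAlgebra k (α → ℤ)}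
    (hf : f ∈ levelSubmodule u k a) (hg : g ∈ levelSubmodule u k b) :
    f * g ∈ levelSubmodule u k (a + b) := by
  classical
  rw [mem_levelSubmodule] at *
  intro m hm i
  obtain ⟨x, hx, y, hy, rfl⟩ := Finset.mem_add.1
    (AddMonoidAlgebra.support_coeff_mul_subset f g (Finsupp.mem_support_iff.2 hm))
  rw [zpair_add]
  exact add_le_add (hf x (Finsupp.mem_support_iff.1 hx) i) (hg y (Finsupp.mem_support_iff.1 hy) i)

theorem toReal_mem_dualCone {m : α → ℤ} : toReal m ∈ dualCone u ↔ ∀ i, 0 ≤ zpair (u i) m := by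
  simp [dualCone, ipair_toReal]

theorem toReal_mem_PK {m : α → ℤ} : toReal m ∈ PK u ↔ ∀ i, 1 ≤ zpair (u i) m := by
  simp only [PK, Set.mem_ofPred_eq, ipair_toReal]
  exact forall_congr' fun i => by norm_cast

theorem toReal_mem_PmK {m : α → ℤ} : toReal m ∈ PmK u ↔ ∀ i, -1 ≤ zpair (u i) m := by
  simp only [PmK, Set.mem_ofPred_eq, ipair_toReal]
  exact forall_congr' fun i => by exact_mod_cast Iff.rfl

theorem mem_toricRing {f : AddMonoidAlgebra k (α → ℤ)} :
    f ∈ toricRing k u ↔ f ∈ levelSubmodule u k 0 := by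
  simp only [toricRing, toReal_mem_dualCone]
  constructor
  · intro hf
    induction hf using Algebra.adjoin_induction with
    | mem x hx =>
      obtain ⟨m, hm, rfl⟩ := hx
      exact mono_mem_levelSubmodule hm
    | algebraMap r =>
      rw [Algebra.algebraMap_eq_smul_one]
      exact Submodule.smul_mem _ _ (mono_mem_levelSubmodule (m := 0) fun i => by simp [zpair])
    | add x y _ _ hx hy => exact add_mem hx hy
    | mul x y _ _ hx hy => simpa using mul_mem_levelSubmodule hx hy
  · rw [levelSubmodule_eq_span]
    exact fun hf => Algebra.span_le_adjoin k _ hf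

/-- The `R`-span of the monomials of level at least `c` consists of all Laurent polynomials of
level at least `c`. -/
theorem mem_span_toricRing {c : ℤ} {f : AddMonoidAlgebra k (α → ℤ)} :
    f ∈ Submodule.span (toricRing k u)
      {g : AddMonoidAlgebra k (α → ℤ) | ∃ m, (∀ i, c ≤ zpair (u i) m) ∧ g = mono k m} ↔
    f ∈ levelSubmodule u k c := by
  constructor
  · intro hf
    induction hf using Submodule.span_induction with
    | mem x hx =>
      obtain ⟨m, hm, rfl⟩ := hx
      exact mono_mem_levelSubmodule hm
    | zero => exact zero_mem _
    | add x y _ _ hx hy => exact add_mem hx hy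
    | smul r x _ hx =>
      simpa [Subalgebra.smul_def] using mul_mem_levelSubmodule (mem_toricRing.1 r.2) hx
  · rw [levelSubmodule_eq_span]
    exact fun hf => Submodule.span_le_restrictScalars k (toricRing k u) _ hf

theorem mem_canMod {f : AddMonoidAlgebra k (α → ℤ)} :
    f ∈ canMod k u ↔ f ∈ levelSubmodule u k 1 := by
  simp only [canMod, toReal_mem_PK, mem_span_toricRing]

theorem mem_antiCanonical {f : AddMonoidAlgebra k (α → ℤ)} :
    f ∈ Submodule.span (toricRing k u)
      {g : AddMonoidAlgebra k (α → ℤ) | ∃ m, toReal m ∈ PmK u ∧ g = mono k m} ↔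
    f ∈ levelSubmodule u k (-1) := by
  simp only [toReal_mem_PmK, mem_span_toricRing]

theorem mul_mem_toricRing {f x : AddMonoidAlgebra k (α → ℤ)} (hf : f ∈ levelSubmodule u k (-1))
    (hx : x ∈ canMod k u) : f * x ∈ toricRing k u :=
  mem_toricRing.2 <| by simpa using mul_mem_levelSubmodule hf (mem_canMod.1 hx)

theorem mono_mem_canMod {m : α → ℤ} (hm : ∀ i, 1 ≤ zpair (u i) m) : mono k m ∈ canMod k u :=
  mem_canMod.2 (mono_mem_levelSubmodule hm)

/-- Multipliers from `ω` to `R` have level at least `-1`. -/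
theorem mem_levelSubmodule_of_forall_mul_mem [Fintype ι] (hu : IsRaySetup u)
    {f : AddMonoidAlgebra k (α → ℤ)}
    (hf : ∀ x ∈ canMod k u, f * x ∈ toricRing k u) : f ∈ levelSubmodule u k (-1) := by
  refine mem_levelSubmodule.2 fun s hs i => ?_
  obtain ⟨m, hmi, hm⟩ := exists_zpair_eq_one_forall_one_le hu i
  have h1 := mem_levelSubmodule.1 (mem_toricRing.1 (hf _ (mono_mem_canMod hm))) (s + m)
    (by simpa [mono, AddMonoidAlgebra.coeff_mul_single_apply] using hs) i
  rw [zpair_add, hmi] at h1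
  omega

/-- A homomorphism `ω → R` is multiplication by a unique Laurent polynomial, whose level is at
least `-1`. -/
theorem existsUnique_mul_eq [Fintype ι] (hu : IsRaySetup u)
    (φ : canMod k u →ₗ[toricRing k u] toricRing k u) :
    ∃! f, f ∈ levelSubmodule u k (-1) ∧
      ∀ x : canMod k u, (φ x : AddMonoidAlgebra k (α → ℤ)) = f * x := by
  obtain ⟨m, hm⟩ := exists_forall_one_le_zpair hu
  let y : canMod k u := ⟨mono k m, mono_mem_canMod hm⟩
  have canMod_le (x : canMod k u) : (x : AddMonoidAlgebra k (α → ℤ)) ∈ toricRing k u :=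
    mem_toricRing.2 <| mem_levelSubmodule.2 fun m hm i =>
      zero_le_one.trans (mem_levelSubmodule.1 (mem_canMod.1 x.2) m hm i)
  have hcomm (x : canMod k u) :
      mono k m * (φ x : AddMonoidAlgebra k (α → ℤ)) = x * φ y := by
    have hxy : (⟨mono k m, canMod_le y⟩ : toricRing k u) • x =
        (⟨x, canMod_le x⟩ : toricRing k u) • y :=
      Subtype.ext (mul_comm _ _)
    have := congrArg (fun z => (φ z : AddMonoidAlgebra k (α → ℤ))) hxy
    simpa using this
  have hφ (x : canMod k u) :
      (φ x : AddMonoidAlgebra k (α → ℤ)) = φ y * mono k (-m) * x := by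
    calc (φ x : AddMonoidAlgebra k (α → ℤ))
        = mono k m * mono k (-m) * φ x := by rw [mono_mul_mono_neg, one_mul]
      _ = mono k (-m) * (mono k m * φ x) := by ring
      _ = φ y * mono k (-m) * x := by rw [hcomm]; ring
  refine ⟨φ y * mono k (-m), ⟨?_, hφ⟩, fun g hg => ?_⟩
  · exact mem_levelSubmodule_of_forall_mul_mem hu fun x hx => by
      rw [← hφ ⟨x, hx⟩]
      exact (φ ⟨x, hx⟩).2
  · rw [hg.2 y, mul_assoc]
    exact (mul_one g).symm.trans (congrArg _ (mono_mul_mono_neg k m).symm)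

variable (u k) in
/-- The `R`-linear map sending a Laurent polynomial of level at least `-1` to multiplication by it,
as a homomorphism `ω → R`. -/
noncomputable def mulHom : Submodule.span (toricRing k u)
      {g : AddMonoidAlgebra k (α → ℤ) | ∃ m, toReal m ∈ PmK u ∧ g = mono k m}
    →ₗ[toricRing k u] canMod k u →ₗ[toricRing k u] toricRing k u where
  toFun f :=
    { toFun := fun x => ⟨f * x, mul_mem_toricRing (mem_antiCanonical.1 f.2) x.2⟩
      map_add' := fun _ _ => Subtype.ext (mul_add _ _ _)
      map_smul' := fun _ _ => Subtype.ext (mul_left_comm _ _ _) }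
  map_add' _ _ := LinearMap.ext fun _ => Subtype.ext (add_mul _ _ _)
  map_smul' _ _ := LinearMap.ext fun _ => Subtype.ext (mul_assoc _ _ _)

theorem mulHom_bijective [Fintype ι] (hu : IsRaySetup u) : Function.Bijective (mulHom u k) := by
  constructor
  · intro f g hfg
    refine Subtype.ext ((existsUnique_mul_eq hu (mulHom u k f)).unique
      ⟨mem_antiCanonical.1 f.2, fun x => rfl⟩ ⟨mem_antiCanonical.1 g.2, fun x => ?_⟩)
    rw [hfg]
    rfl
  · intro φ
    obtain ⟨f, hf, hφ⟩ := (existsUnique_mul_eq hu φ).exists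
    exact ⟨⟨f, mem_antiCanonical.2 hf⟩, LinearMap.ext fun x => Subtype.ext (hφ x).symm⟩

end Module

/-- Every `R`-module homomorphism `φ : ω → R` is given by multiplication
(inside the Laurent polynomial ring) by a unique element of the `k`-span of the monomials
`χ^{m'}`, `m' ∈ P_{-K} ∩ M`; conversely multiplication by any element of that span maps `ω`
into `R`.  Hence `Hom_R(ω, R)` is isomorphic as an `R`-module to the `R`-submodule of
`k[ℤ^n]` spanned by these monomials. -/
theorem hom_canMod_eq_antiCanonical
    {n : ℕ} {ι : Type} [Fintype ι] (u : ι → Fin n → ℤ) (hu : IsRaySetup u)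
    (k : Type) [Field k] [IsAlgClosed k] [CharZero k] :
    (∀ φ : ↥(canMod k u) →ₗ[↥(toricRing k u)] ↥(toricRing k u),
      ∃! f : AddMonoidAlgebra k (Fin n → ℤ),
        f ∈ Submodule.span k {g : AddMonoidAlgebra k (Fin n → ℤ) |
            ∃ m' : Fin n → ℤ, toReal m' ∈ PmK u ∧ g = mono k m'} ∧
        ∀ x : ↥(canMod k u), ((φ x : ↥(toricRing k u)) : AddMonoidAlgebra k (Fin n → ℤ)) =
          f * (x : AddMonoidAlgebra k (Fin n → ℤ))) ∧
    (∀ f ∈ Submodule.span k {g : AddMonoidAlgebra k (Fin n → ℤ) |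
        ∃ m' : Fin n → ℤ, toReal m' ∈ PmK u ∧ g = mono k m'},
      ∀ x : ↥(canMod k u), ∃ r : ↥(toricRing k u),
        (r : AddMonoidAlgebra k (Fin n → ℤ)) = f * (x : AddMonoidAlgebra k (Fin n → ℤ))) ∧
    Nonempty ((↥(canMod k u) →ₗ[↥(toricRing k u)] ↥(toricRing k u)) ≃ₗ[↥(toricRing k u)]
      ↥(Submodule.span ↥(toricRing k u) {g : AddMonoidAlgebra k (Fin n → ℤ) |
          ∃ m' : Fin n → ℤ, toReal m' ∈ PmK u ∧ g = mono k m'})) := by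
  simp only [toReal_mem_PmK, ← levelSubmodule_eq_span]
  exact ⟨existsUnique_mul_eq hu, fun f hf x => ⟨⟨f * x, mul_mem_toricRing hf x.2⟩, rfl⟩,
    ⟨(LinearEquiv.ofBijective (mulHom u k) (mulHom_bijective hu)).symm⟩⟩
end

section
/- Let F be a face of σ^∨, let w ∈ F ∩ ℤ^n, and let z ∈ P_K ∩ ℤ^n be such that w − z ∈ P_{−K}. Then z ∈ F[1]. -/
set_option synthInstance.maxHeartbeats 1000000
set_option maxHeartbeats 1000000

/-- Let `F` be a face of `σ^∨`, `w ∈ F ∩ ℤ^n`, and `z ∈ P_K ∩ ℤ^n` with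
`w - z ∈ P_{-K}`.  Then `z ∈ F[1]`. -/
theorem mem_faceShift_of_decomposition
    {n : ℕ} {ι : Type} [Fintype ι] (u : ι → Fin n → ℤ) (hu : IsRaySetup u)
    (F : Set (Fin n → ℝ)) (hF : IsFaceOfDual u F)
    (w : Fin n → ℤ) (hw : toReal w ∈ F)
    (z : Fin n → ℤ) (hz : toReal z ∈ PK u)
    (hwz : toReal (w - z) ∈ PmK u) :
    toReal z ∈ faceShift u F := by
  intro i hi
  have h_sub : ipair (u i) (toReal (w - z)) = ipair (u i) (toReal w) - ipair (u i) (toReal z) := by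
    simp [ipair, toReal, mul_sub, Finset.sum_sub_distrib]
  have h_upper := hwz i
  rw [h_sub, hi _ hw] at h_upper
  exact le_antisymm (by linarith) (hz i)
end

section
/- Let φ : P̄ → P' be a quotient poset of P̄. Then there exists a function ψ : P̄ → ℤ satisfying ψ(a) = ψ(b) + 1 for every covering relation a ⋖ b of P̄ with φ(a) = φ(b) (i.e. F_φ[1] contains a lattice point), if and only if every fibre φ^{-1}(p'), equipped with the order relation restricted from P̄, is a graded poset. -/
noncomputable section

/-- `ψ : Q → ℤ` is a grading of the poset `Q`: it drops by exactly one along every covering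
relation (functions here are order-reversing, matching the conventions for Hibi rings). -/
def IsGrading (Q : Type*) [PartialOrder Q] (ψ : Q → ℤ) : Prop :=
  ∀ a b : Q, a ⋖ b → ψ a = ψ b + 1

/-- a poset is graded if it admits a grading -/
def IsGradedPoset (Q : Type*) [PartialOrder Q] : Prop :=
  ∃ ψ : Q → ℤ, IsGrading Q ψ

/-- a subset `A` of a poset is connected: any two of its elements are joined by a finite
sequence inside `A` in which consecutive elements are comparable -/
def ConnSubset {Q : Type*} [PartialOrder Q] (A : Set Q) : Prop :=
  ∀ x ∈ A, ∀ y ∈ A,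
    Relation.ReflTransGen (fun p q : Q => p ∈ A ∧ q ∈ A ∧ (p ≤ q ∨ q ≤ p)) x y

/-- a subset `A` of a poset is order-convex: `a ≤ b ≤ c` with `a, c ∈ A` implies `b ∈ A` -/
def OrderConvex {Q : Type*} [PartialOrder Q] (A : Set Q) : Prop :=
  ∀ a b c : Q, a ≤ b → b ≤ c → a ∈ A → c ∈ A → b ∈ A

/-- a complete subset: nonempty, connected and order-convex (exactly the subsets occurring as
fibres of quotient poset maps) -/
def CompleteSubset {Q : Type*} [PartialOrder Q] (A : Set Q) : Prop :=
  A.Nonempty ∧ ConnSubset A ∧ OrderConvex A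

/-- `φ : Q → Q'` is a quotient poset map: surjective, order preserving, with connected fibres,
such that the order on `Q'` is the transitive closure of the relation
`a' ≤ b' ↔ ∃ a ∈ φ⁻¹(a'), b ∈ φ⁻¹(b'), a ≤ b`. -/
def IsQuotientPosetMap {Q Q' : Type*} [PartialOrder Q] [PartialOrder Q']
    (φ : Q → Q') : Prop :=
  Function.Surjective φ ∧ Monotone φ ∧ (∀ q' : Q', ConnSubset (φ ⁻¹' {q'})) ∧
    ∀ a' b' : Q', a' ≤ b' ↔
      Relation.TransGen (fun x' y' : Q' => ∃ a b : Q, φ a = x' ∧ φ b = y' ∧ a ≤ b) a' b'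

end

/-- On a fibre of a monotone map, the covering relation is the restriction of the ambient one. -/
theorem Monotone.fibre_covBy_iff {Q Q' : Type*} [PartialOrder Q] [PartialOrder Q'] {φ : Q → Q'}
    (hφ : Monotone φ) {p' : Q'} {a b : {x : Q // φ x = p'}} : a ⋖ b ↔ (a : Q) ⋖ b := by
  refine ⟨fun h => ⟨h.lt, fun c hac hcb => ?_⟩, fun h => ⟨h.lt, fun c hac hcb => h.2 hac hcb⟩⟩
  have hc : φ c = p' :=
    le_antisymm ((hφ hcb.le).trans_eq b.2) (a.2.symm.trans_le (hφ hac.le))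
  exact h.2 (c := ⟨c, hc⟩) hac hcb

/-- For a quotient poset `φ : P̄ → P'` of `P̄ = P ∪ {-∞, ∞}`, there is a
function `ψ : P̄ → ℤ` with `ψ a = ψ b + 1` for every covering relation `a ⋖ b` of `P̄` with
`φ a = φ b` (i.e. `F_φ[1]` contains a lattice point) iff every fibre of `φ`, with the
restricted order, is a graded poset. -/
theorem faceShift_lattice_point_iff_fibres_graded
    (P : Type) [Fintype P] [PartialOrder P]
    (P' : Type) [PartialOrder P']
    (φ : WithBot (WithTop P) → P') (hφ : IsQuotientPosetMap φ) :
    (∃ ψ : WithBot (WithTop P) → ℤ,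
        ∀ a b : WithBot (WithTop P), a ⋖ b → φ a = φ b → ψ a = ψ b + 1) ↔
      ∀ p' : P', IsGradedPoset {x : WithBot (WithTop P) // φ x = p'} := by
  have hmono : Monotone φ := hφ.2.1
  constructor
  · rintro ⟨ψ, hψ⟩ p'
    exact ⟨fun x => ψ x, fun a b hab =>
      hψ a b (hmono.fibre_covBy_iff.1 hab) (a.2.trans b.2.symm)⟩
  · intro h
    choose ψ hψ using h
    have hext : ∀ (p' : P') (x : WithBot (WithTop P)) (hx : φ x = p'),
        ψ (φ x) ⟨x, rfl⟩ = ψ p' ⟨x, hx⟩ := by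
      rintro _ x rfl
      rfl
    refine ⟨fun x => ψ (φ x) ⟨x, rfl⟩, fun a b hab he => ?_⟩
    exact (hext (φ b) a he).trans
      (hψ (φ b) ⟨a, he⟩ ⟨b, rfl⟩ (hmono.fibre_covBy_iff.2 hab))
end

section
/- A nonempty subset A of a finite poset Q occurs as a fibre of some quotient poset map φ : Q → Q' if and only if A is connected and order-convex (that is, a ≤ b ≤ c with a, c ∈ A implies b ∈ A). -/
/-- The poset `Q`, to be preordered so that all elements of `A` become equivalent. -/
def Collapse {Q : Type*} (_A : Set Q) : Type _ := Q

/-- The smallest preorder containing the order of `Q` and identifying the elements of `A`. -/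
instance Collapse.instPreorder {Q : Type*} [PartialOrder Q] (A : Set Q) :
    Preorder (Collapse A) where
  le x y := LE.le (α := Q) x y ∨
    (∃ a ∈ A, LE.le (α := Q) x a) ∧ ∃ b ∈ A, LE.le (α := Q) b y
  le_refl x := Or.inl (le_refl (α := Q) x)
  le_trans x y z := by
    rintro (hxy | ⟨hx, b, hb, hby⟩) (hyz | ⟨⟨a, ha, hya⟩, hz⟩)
    · exact Or.inl (le_trans (α := Q) hxy hyz)
    · exact Or.inr ⟨⟨a, ha, le_trans (α := Q) hxy hya⟩, hz⟩
    · exact Or.inr ⟨hx, b, hb, le_trans (α := Q) hby hyz⟩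
    · exact Or.inr ⟨hx, hz⟩

/-- The map collapsing `A` to a point. -/
def collapseMap {Q : Type*} [PartialOrder Q] (A : Set Q) (x : Q) :
    Antisymmetrization (Collapse A) (· ≤ ·) :=
  toAntisymmetrization (α := Collapse A) (· ≤ ·) x

theorem collapseMap_le_iff {Q : Type*} [PartialOrder Q] {A : Set Q} {x y : Q} :
    collapseMap A x ≤ collapseMap A y ↔ x ≤ y ∨ (∃ a ∈ A, x ≤ a) ∧ ∃ b ∈ A, b ≤ y :=
  Iff.rfl

theorem collapseMap_surjective {Q : Type*} [PartialOrder Q] (A : Set Q) :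
    Function.Surjective (collapseMap A) :=
  Quotient.mk_surjective

theorem collapseMap_eq_of_mem {Q : Type*} [PartialOrder Q] {A : Set Q} {x y : Q}
    (hx : x ∈ A) (hy : y ∈ A) : collapseMap A x = collapseMap A y :=
  le_antisymm (collapseMap_le_iff.2 (Or.inr ⟨⟨x, hx, le_rfl⟩, y, hy, le_rfl⟩))
    (collapseMap_le_iff.2 (Or.inr ⟨⟨y, hy, le_rfl⟩, x, hx, le_rfl⟩))

theorem collapseMap_eq_iff {Q : Type*} [PartialOrder Q] {A : Set Q} (hA : OrderConvex A)
    {x y : Q} : collapseMap A x = collapseMap A y ↔ x = y ∨ x ∈ A ∧ y ∈ A := by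
  refine ⟨fun h => ?_, ?_⟩
  · rcases collapseMap_le_iff.1 h.le with hxy | ⟨⟨a, ha, hxa⟩, b, hb, hby⟩ <;>
      rcases collapseMap_le_iff.1 h.ge with hyx | ⟨⟨c, hc, hyc⟩, d, hd, hdx⟩
    · exact Or.inl (le_antisymm hxy hyx)
    · exact Or.inr ⟨hA d x c hdx (hxy.trans hyc) hd hc, hA d y c (hdx.trans hxy) hyc hd hc⟩
    · exact Or.inr ⟨hA b x a (hby.trans hyx) hxa hb ha, hA b y a hby (hyx.trans hxa) hb ha⟩
    · exact Or.inr ⟨hA d x a hdx hxa hd ha, hA b y c hby hyc hb hc⟩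
  · rintro (rfl | ⟨hx, hy⟩)
    · rfl
    · exact collapseMap_eq_of_mem hx hy

theorem preimage_collapseMap_of_mem {Q : Type*} [PartialOrder Q] {A : Set Q}
    (hA : OrderConvex A) {x : Q} (hx : x ∈ A) : collapseMap A ⁻¹' {collapseMap A x} = A := by
  ext y
  rw [Set.mem_preimage, Set.mem_singleton_iff, collapseMap_eq_iff hA]
  exact ⟨fun h => h.elim (fun e => e ▸ hx) And.left, fun hy => Or.inr ⟨hy, hx⟩⟩

theorem preimage_collapseMap_of_notMem {Q : Type*} [PartialOrder Q] {A : Set Q}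
    (hA : OrderConvex A) {x : Q} (hx : x ∉ A) : collapseMap A ⁻¹' {collapseMap A x} = {x} := by
  ext y
  simp [collapseMap_eq_iff hA, hx]

theorem connSubset_singleton {Q : Type*} [PartialOrder Q] (x : Q) : ConnSubset {x} := by
  rintro _ rfl _ rfl
  exact .refl

theorem isQuotientPosetMap_collapseMap {Q : Type*} [PartialOrder Q] {A : Set Q}
    (hconn : ConnSubset A) (hconv : OrderConvex A) : IsQuotientPosetMap (collapseMap A) := by
  have hmono : Monotone (collapseMap A) := fun x y h => collapseMap_le_iff.2 (Or.inl h)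
  refine ⟨collapseMap_surjective A, hmono, fun q => ?_, fun p q => ⟨fun h => ?_, fun h => ?_⟩⟩
  · obtain ⟨x, rfl⟩ := collapseMap_surjective A q
    by_cases hx : x ∈ A
    · rwa [preimage_collapseMap_of_mem hconv hx]
    · rw [preimage_collapseMap_of_notMem hconv hx]
      exact connSubset_singleton x
  · obtain ⟨x, rfl⟩ := collapseMap_surjective A p
    obtain ⟨y, rfl⟩ := collapseMap_surjective A q
    rcases collapseMap_le_iff.1 h with hxy | ⟨⟨a, ha, hxa⟩, b, hb, hby⟩
    · exact .single ⟨x, y, rfl, rfl, hxy⟩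
    · exact .tail (.single ⟨x, a, rfl, rfl, hxa⟩) ⟨b, y, collapseMap_eq_of_mem hb ha, rfl, hby⟩
  · induction h with
    | single h =>
      obtain ⟨x, y, rfl, rfl, hxy⟩ := h
      exact hmono hxy
    | tail _ h ih =>
      obtain ⟨x, y, rfl, rfl, hxy⟩ := h
      exact ih.trans (hmono hxy)

theorem orderConvex_preimage_singleton {Q Q' : Type*} [PartialOrder Q] [PartialOrder Q']
    {φ : Q → Q'} (hφ : Monotone φ) (q : Q') : OrderConvex (φ ⁻¹' {q}) := by
  intro a b c hab hbc ha hc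
  exact le_antisymm ((hφ hbc).trans_eq hc) (ha.symm.trans_le (hφ hab))

/-- A nonempty subset `A` of a finite poset `Q` occurs as a fibre of some
quotient poset map `φ : Q → Q'` iff `A` is connected and order-convex. -/
theorem fibre_iff_connected_convex
    (Q : Type) [Fintype Q] [PartialOrder Q] (A : Set Q) (hA : A.Nonempty) :
    (∃ (Q' : Type) (_ : PartialOrder Q') (φ : Q → Q'),
        IsQuotientPosetMap φ ∧ ∃ q' : Q', A = φ ⁻¹' {q'}) ↔
      ConnSubset A ∧ OrderConvex A := by
  constructor
  · rintro ⟨Q', _, φ, ⟨-, hmono, hconn, -⟩, q, rfl⟩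
    exact ⟨hconn q, orderConvex_preimage_singleton hmono q⟩
  · rintro ⟨hconn, hconv⟩
    obtain ⟨x, hx⟩ := hA
    exact ⟨_, inferInstance, collapseMap A, isQuotientPosetMap_collapseMap hconn hconv,
      collapseMap A x, (preimage_collapseMap_of_mem hconv hx).symm⟩
end

section
/- The minimal primes of the Hibi ring R(P) lying over tr(ω) are exactly the ideals p_{F_A}, where A ranges over the subsets of P̄ that are minimal (with respect to inclusion) among the complete, non-graded subsets of P̄; moreover the assignment A ↦ p_{F_A} is a bijection between these minimal subsets and the minimal primes over tr(ω) (equivalently, the maximal components of the non-Gorenstein locus). -/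
noncomputable section

set_option synthInstance.maxHeartbeats 1000000
set_option maxHeartbeats 1000000

/-- `P̄ = P ∪ {-∞, ∞}`: the poset `P` with a new minimum and a new maximum adjoined -/
abbrev Pbar (P : Type) [PartialOrder P] : Type := WithBot (WithTop P)

variable (k : Type) [Field k] (P : Type) [Fintype P] [PartialOrder P]

/-- the monomial `χ^ψ` in the Laurent polynomial ring -/
def hibiMono (ψ : Pbar P → ℤ) : AddMonoidAlgebra k (Pbar P → ℤ) :=
  AddMonoidAlgebra.single ψ 1

/-- a lattice point of the cone `C(P)`: an order-reversing integral function on `P̄`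
with `ψ(∞) = 0` -/
def InConeP (ψ : Pbar P → ℤ) : Prop := Antitone ψ ∧ ψ ⊤ = 0

/-- the Hibi ring `R(P) = k[C(P) ∩ ℤ^{P ∪ {-∞}}]`, the subalgebra of the Laurent polynomial
ring spanned by the monomials `χ^ψ` with `ψ` an integral point of `C(P)` -/
def hibiRing : Subalgebra k (AddMonoidAlgebra k (Pbar P → ℤ)) :=
  Algebra.adjoin k {f | ∃ ψ : Pbar P → ℤ, InConeP P ψ ∧ f = hibiMono k P ψ}

/-- the canonical module `ω` of the Hibi ring: spanned by the monomials `χ^ψ` with `ψ`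
integral, `ψ(∞) = 0` and `ψ a ≥ ψ b + 1` for every covering relation `a ⋖ b` of `P̄` -/
def hibiOmega : Submodule ↥(hibiRing k P) (AddMonoidAlgebra k (Pbar P → ℤ)) :=
  Submodule.span ↥(hibiRing k P)
    {f | ∃ ψ : Pbar P → ℤ, ψ ⊤ = 0 ∧
      (∀ a b : Pbar P, a ⋖ b → ψ b + 1 ≤ ψ a) ∧ f = hibiMono k P ψ}

/-- the trace ideal `tr(ω)` of the canonical module of the Hibi ring -/
def hibiTrace : Ideal ↥(hibiRing k P) :=
  Ideal.span {r | ∃ (φ : ↥(hibiOmega k P) →ₗ[↥(hibiRing k P)] ↥(hibiRing k P))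
    (x : ↥(hibiOmega k P)), φ x = r}

end

/-- the graded prime `p_{F_A}` of the Hibi ring associated to a complete subset `A ⊆ P̄`:
spanned by the monomials `χ^ψ` with `ψ` an integral point of `C(P)` not constant on `A` -/
noncomputable def hibiFacePrime (k : Type) [Field k] (P : Type) [Fintype P] [PartialOrder P]
    (A : Set (Pbar P)) : Ideal ↥(hibiRing k P) :=
  Ideal.span {r | ∃ ψ : Pbar P → ℤ, InConeP P ψ ∧ ¬ (∀ a ∈ A, ∀ b ∈ A, ψ a = ψ b) ∧
    (r : AddMonoidAlgebra k (Pbar P → ℤ)) = hibiMono k P ψ}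

section Poset

theorem Relation.ReflTransGen.symm_of_forall {X : Type*} {r : X → X → Prop}
    (hr : ∀ a b, r a b → r b a) {a b : X} (h : Relation.ReflTransGen r a b) :
    Relation.ReflTransGen r b a := by
  induction h with
  | refl => exact .refl
  | tail _ h ih => exact .head (hr _ _ h) ih

variable {Q : Type*} [PartialOrder Q]

/-- A finite poset carries a strictly order-reversing integral function dropping by exactly one
along a prescribed covering relation. -/
theorem exists_strictAnti_eq_add_one_of_covBy [Finite Q] {a b : Q} (hab : a ⋖ b) :
    ∃ h : Q → ℤ, StrictAnti h ∧ h a = h b + 1 := by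
  classical
  let U : Q → Set Q := fun x => {z | x < z ∨ (x ≤ b ∧ a < z ∧ (z = b → x ≠ b))}
  refine ⟨fun x => ((U x).ncard : ℤ), fun x y hxy => ?_, ?_⟩
  · have hss : U y ⊂ U x := by
      refine ⟨fun z hz => ?_, fun hsub => ?_⟩
      · rcases hz with hz | ⟨h1, h2, -⟩
        · exact Or.inl (hxy.trans hz)
        · exact Or.inr ⟨hxy.le.trans h1, h2, fun _ => (hxy.trans_le h1).ne⟩
      · rcases hsub (show y ∈ U x from Or.inl hxy) with h | ⟨h1, h2, h3⟩
        · exact lt_irrefl _ h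
        · rcases h1.lt_or_eq with h4 | h4
          · exact hab.2 h2 h4
          · exact h3 h4 h4
    exact Nat.cast_lt.2 (Set.ncard_lt_ncard hss (Set.toFinite _))
  · have hU : U a = insert b (U b) := by
      ext z
      simp only [U, Set.mem_ofPred_eq, Set.mem_insert_iff]
      constructor
      · intro h
        have haz : a < z := by
          rcases h with h | h
          · exact h
          · exact h.2.1
        by_cases hz : z = b
        · exact Or.inl hz
        · exact Or.inr (Or.inr ⟨le_rfl, haz, fun h => absurd h hz⟩)
      · rintro (rfl | h | h)
        · exact Or.inl hab.lt
        · exact Or.inl (hab.lt.trans h)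
        · exact Or.inl h.2.1
    have hb : b ∉ U b := by
      rintro (h | h)
      · exact lt_irrefl _ h
      · exact h.2.2 rfl rfl
    simp only [hU]
    rw [Set.ncard_insert_of_notMem hb (Set.toFinite _)]
    push_cast
    ring

/-- Distinct points outside an order-convex subset are separated by a lower set which either
contains or avoids that subset. -/
theorem OrderConvex.exists_isLowerSet_separating {A : Set Q} (hA : OrderConvex A) {x y : Q}
    (hx : x ∉ A) (hxy : x ≠ y) :
    ∃ D : Set Q, IsLowerSet D ∧ (∀ a ∈ A, ∀ b ∈ A, a ∈ D → b ∈ D) ∧ ¬ (x ∈ D ↔ y ∈ D) := by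
  let D : Q → Set Q := fun u => {z | z ≤ u ∨ ∃ a ∈ A, ∃ b ∈ A, a ≤ u ∧ z ≤ b}
  have hlow : ∀ u, IsLowerSet (D u) := by
    rintro u p q hqp (h | ⟨a, ha, b, hb, h1, h2⟩)
    · exact Or.inl (hqp.trans h)
    · exact Or.inr ⟨a, ha, b, hb, h1, hqp.trans h2⟩
  have hcomp : ∀ u, ∀ a ∈ A, ∀ b ∈ A, a ∈ D u → b ∈ D u := by
    rintro u a ha b hb (h | ⟨a', ha', -, -, h1, -⟩)
    · exact Or.inr ⟨a, ha, b, hb, h, le_rfl⟩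
    · exact Or.inr ⟨a', ha', b, hb, h1, le_rfl⟩
  by_cases h1 : y ∈ D x
  · by_cases h2 : x ∈ D y
    · exfalso
      rcases h1 with h1 | ⟨a, ha, b, hb, hax, hyb⟩ <;>
        rcases h2 with h2 | ⟨c, hc, d, hd, hcy, hxd⟩
      · exact hxy (le_antisymm h2 h1)
      · exact hx (hA c x d (hcy.trans h1) hxd hc hd)
      · exact hx (hA a x b hax (h2.trans hyb) ha hb)
      · exact hx (hA a x d hax hxd ha hd)
    · exact ⟨D y, hlow y, hcomp y, fun h => h2 (h.2 (Or.inl le_rfl))⟩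
  · exact ⟨D x, hlow x, hcomp x, fun h => h1 (h.1 (Or.inl le_rfl))⟩

/-- A function that agrees on comparable elements of a connected subset is constant on it. -/
theorem ConnSubset.apply_eq {X : Type*} {A : Set Q} (hA : ConnSubset A) {f : Q → X}
    (hf : ∀ a ∈ A, ∀ b ∈ A, a ≤ b → f a = f b) : ∀ a ∈ A, ∀ b ∈ A, f a = f b := by
  intro a ha b hb
  have h := hA a ha b hb
  induction h with
  | refl => rfl
  | tail _ h ih =>
    obtain ⟨h1, h2, h3 | h3⟩ := h
    · exact (ih h1).trans (hf _ h1 _ h2 h3)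
    · exact (ih h1).trans (hf _ h2 _ h1 h3).symm

theorem isGradedPoset_of_subsingleton [Subsingleton Q] : IsGradedPoset Q :=
  ⟨0, fun a b h => absurd (Subsingleton.elim a b) h.ne⟩

theorem OrderConvex.covBy_of_subtype_covBy {A : Set Q} (hA : OrderConvex A) {a b : A}
    (h : a ⋖ b) : (a : Q) ⋖ b :=
  ⟨h.1, fun c hac hcb => h.2 (c := ⟨c, hA a c b hac.le hcb.le a.2 b.2⟩) hac hcb⟩

/-- The relation whose reflexive-transitive closure cuts the fibres of `f` into connected
components. -/
def FibreAdj {X : Type*} (f : Q → X) (p q : Q) : Prop :=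
  f p = f q ∧ (p ≤ q ∨ q ≤ p)

/-- The setoid on `Q` whose classes are the connected components of the fibres of `f`. -/
def fibreSetoid {X : Type*} (f : Q → X) : Setoid Q where
  r := Relation.ReflTransGen (FibreAdj f)
  iseqv :=
    ⟨fun _ => Relation.ReflTransGen.refl,
      fun h => Relation.ReflTransGen.symm_of_forall (fun _ _ h => ⟨h.1.symm, h.2.symm⟩) h,
      fun h h' => h.trans h'⟩

theorem apply_eq_of_fibreSetoid {X : Type*} {f : Q → X} {a b : Q} (h : (fibreSetoid f).r a b) :
    f a = f b := by
  replace h : Relation.ReflTransGen (FibreAdj f) a b := h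
  induction h with
  | refl => rfl
  | tail _ h ih => exact ih.trans h.1

theorem Antitone.completeSubset_fibre_component {f : Q → ℤ} (hf : Antitone f) (a : Q) :
    CompleteSubset {b | (fibreSetoid f).r a b} := by
  have key : ∀ b, Relation.ReflTransGen (FibreAdj f) a b →
      Relation.ReflTransGen (fun p q : Q => p ∈ {b | (fibreSetoid f).r a b} ∧
        q ∈ {b | (fibreSetoid f).r a b} ∧ (p ≤ q ∨ q ≤ p)) a b := by
    intro b h
    induction h with
    | refl => exact .refl
    | tail h1 h2 ih => exact ih.tail ⟨h1, h1.tail h2, h2.2⟩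
  refine ⟨⟨a, (fibreSetoid f).refl a⟩, fun x hx y hy => ?_, fun x y z hxy hyz hx hz => ?_⟩
  · exact (Relation.ReflTransGen.symm_of_forall (fun _ _ h => ⟨h.2.1, h.1, h.2.2.symm⟩)
      (key x hx)).trans (key y hy)
  · have h1 := apply_eq_of_fibreSetoid hx
    have h2 := apply_eq_of_fibreSetoid hz
    have h3 : f x = f y := le_antisymm (by linarith [hf hyz]) (hf hxy)
    exact (show Relation.ReflTransGen (FibreAdj f) a x from hx).tail ⟨h3, Or.inl hxy⟩

/-- If all connected components of the fibres of `f` are graded, their gradings glue to a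
function that drops by one along each covering relation inside a fibre. -/
theorem exists_grading_along_fibres {f : Q → ℤ}
    (h : ∀ a, IsGradedPoset ↥{b | (fibreSetoid f).r a b}) :
    ∃ g : Q → ℤ, ∀ a b : Q, a ⋖ b → f a = f b → g a = g b + 1 := by
  choose γ hγ using h
  let rep : Q → Q := fun a => (Quotient.mk (fibreSetoid f) a).out
  have hrep : ∀ a, (fibreSetoid f).r (rep a) a := fun a => Quotient.mk_out (s := fibreSetoid f) a
  have transport : ∀ c d b : Q, c = d → ∀ (hc : (fibreSetoid f).r c b)
      (hd : (fibreSetoid f).r d b), γ c ⟨b, hc⟩ = γ d ⟨b, hd⟩ := by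
    rintro c _ b rfl _ _
    rfl
  refine ⟨fun a => γ (rep a) ⟨a, hrep a⟩, fun a b hab hf => ?_⟩
  have hr : (fibreSetoid f).r a b := Relation.ReflTransGen.single ⟨hf, Or.inl hab.le⟩
  have heq : rep b = rep a :=
    congrArg Quotient.out (Quotient.sound (s := fibreSetoid f) ((fibreSetoid f).symm hr))
  have hb : (fibreSetoid f).r (rep a) b := (fibreSetoid f).trans (hrep a) hr
  have := hγ (rep a) ⟨a, hrep a⟩ ⟨b, hb⟩ ⟨hab.lt, fun _ hac hcb => hab.2 hac hcb⟩
  exact this.trans (congrArg (· + 1) (transport _ _ b heq.symm hb (hrep b)))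

theorem antitone_of_covBy_le [Finite Q] {f : Q → ℤ} (h : ∀ a b, a ⋖ b → f b ≤ f a) :
    Antitone f := by
  classical
  have := Fintype.ofFinite Q
  let _ : LocallyFiniteOrder Q := Fintype.toLocallyFiniteOrder
  exact (antitone_iff_forall_covBy f).2 h

/-- If all connected components of the fibres of the order-reversing function `f` are graded, then
a positive multiple of `f` is the sum of a function dropping by at least one along each covering
relation and a function increasing by at most one along each covering relation. -/
theorem exists_add_eq_nsmul_of_graded_components [Finite Q] [OrderTop Q] {f : Q → ℤ}
    (hf : Antitone f) (hf0 : f ⊤ = 0) (h : ∀ a, IsGradedPoset ↥{b | (fibreSetoid f).r a b}) :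
    ∃ (n : ℕ) (ψ ψ' : Q → ℤ), ψ ⊤ = 0 ∧ ψ' ⊤ = 0 ∧ (∀ a b, a ⋖ b → ψ b + 1 ≤ ψ a) ∧
      (∀ a b, a ⋖ b → ψ' b ≤ ψ' a + 1) ∧ ψ + ψ' = n • f := by
  classical
  have := Fintype.ofFinite Q
  obtain ⟨g, hg⟩ := exists_grading_along_fibres h
  let N : ℕ := 1 + ∑ p : Q × Q, (g p.1 - g p.2).natAbs
  have hN : ∀ a b, |g a - g b| + 1 ≤ (N : ℤ) := by
    intro a b
    have := Finset.single_le_sum (f := fun p : Q × Q => (g p.1 - g p.2).natAbs)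
      (fun _ _ => Nat.zero_le _) (Finset.mem_univ (a, b))
    simp only at this
    rw [Int.abs_eq_natAbs]
    omega
  have key : ∀ a b, a ⋖ b → (f a = f b ∧ g a = g b + 1) ∨
      |g a - g b| + 1 ≤ (N : ℤ) * (f a - f b) := by
    intro a b hab
    rcases (hf hab.le).eq_or_lt with h1 | h1
    · exact Or.inl ⟨h1.symm, hg a b hab h1.symm⟩
    · refine Or.inr ((hN a b).trans ?_)
      nlinarith
  refine ⟨2 * N, fun x => N * f x + (g x - g ⊤), fun x => N * f x - (g x - g ⊤),
    ?_, ?_, ?_, ?_, ?_⟩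
  · simp [hf0]
  · simp [hf0]
  · intro a b hab
    rcases key a b hab with ⟨h1, h2⟩ | h1
    · simp only [h1, h2]
      linarith
    · have := neg_abs_le (g a - g b)
      simp only
      linarith
  · intro a b hab
    rcases key a b hab with ⟨h1, h2⟩ | h1
    · simp only [h1, h2]
      linarith
    · have := le_abs_self (g a - g b)
      simp only
      linarith
  · ext x
    simp only [Pi.add_apply, Pi.smul_apply, nsmul_eq_mul]
    push_cast
    ring

end Poset

noncomputable section Algebra

variable (k : Type) [Field k] (P : Type) [PartialOrder P]

variable {P} in
theorem InConeP.add {ψ χ : Pbar P → ℤ} (hψ : InConeP P ψ) (hχ : InConeP P χ) :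
    InConeP P (ψ + χ) :=
  ⟨hψ.1.add hχ.1, by simp [hψ.2, hχ.2]⟩

theorem inConeP_zero : InConeP P 0 :=
  ⟨antitone_const, rfl⟩

theorem hibiMono_mul (ψ χ : Pbar P → ℤ) :
    hibiMono k P ψ * hibiMono k P χ = hibiMono k P (ψ + χ) := by
  simp [hibiMono]

theorem hibiRing_toSubmodule_eq_span :
    Subalgebra.toSubmodule (hibiRing k P) =
      Submodule.span k {f | ∃ ψ : Pbar P → ℤ, InConeP P ψ ∧ f = hibiMono k P ψ} := by
  let M : Submonoid (AddMonoidAlgebra k (Pbar P → ℤ)) :=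
    { carrier := {f | ∃ ψ : Pbar P → ℤ, InConeP P ψ ∧ f = hibiMono k P ψ}
      one_mem' := ⟨0, inConeP_zero P, rfl⟩
      mul_mem' := by
        rintro _ _ ⟨ψ, hψ, rfl⟩ ⟨χ, hχ, rfl⟩
        exact ⟨ψ + χ, hψ.add hχ, hibiMono_mul k P ψ χ⟩ }
  have : Submonoid.closure {f | ∃ ψ : Pbar P → ℤ, InConeP P ψ ∧ f = hibiMono k P ψ} = M :=
    Submonoid.closure_eq M
  rw [hibiRing, Algebra.adjoin_eq_span, this]
  rfl

theorem mem_hibiRing_iff_mem_span {x : AddMonoidAlgebra k (Pbar P → ℤ)} :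
    x ∈ hibiRing k P ↔
      x ∈ Submodule.span k {f | ∃ ψ : Pbar P → ℤ, InConeP P ψ ∧ f = hibiMono k P ψ} := by
  rw [← hibiRing_toSubmodule_eq_span, Subalgebra.mem_toSubmodule]

variable {P} in
/-- The monomial `χ^ψ` of a lattice point of the cone as an element of the Hibi ring. -/
def coneMono {ψ : Pbar P → ℤ} (hψ : InConeP P ψ) : hibiRing k P :=
  ⟨hibiMono k P ψ, Algebra.subset_adjoin ⟨ψ, hψ, rfl⟩⟩

variable {P} in
theorem coneMono_mul {ψ χ : Pbar P → ℤ} (hψ : InConeP P ψ) (hχ : InConeP P χ) :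
    coneMono k hψ * coneMono k hχ = coneMono k (hψ.add hχ) :=
  Subtype.ext (hibiMono_mul k P ψ χ)

variable {k P} in
theorem inConeP_of_coeff_ne_zero {x : AddMonoidAlgebra k (Pbar P → ℤ)} (hx : x ∈ hibiRing k P)
    {ψ : Pbar P → ℤ} (h : x.coeff ψ ≠ 0) : InConeP P ψ := by
  classical
  rw [mem_hibiRing_iff_mem_span] at hx
  contrapose! h
  induction hx using Submodule.span_induction with
  | mem x hx =>
    obtain ⟨χ, hχ, rfl⟩ := hx
    rw [hibiMono, AddMonoidAlgebra.coeff_single, Finsupp.single_apply, if_neg]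
    rintro rfl
    exact h hχ
  | zero => simp
  | add x y _ _ hx hy => simp [hx, hy]
  | smul c x _ hx => simp [hx]

/-- The functions constant on `A`. -/
def ConstOn {X Y : Type*} (A : Set X) (ψ : X → Y) : Prop :=
  ∀ a ∈ A, ∀ b ∈ A, ψ a = ψ b

open Classical in
/-- The linear projection of the Laurent polynomial ring onto the span of the monomials whose
exponent is constant on `A`. -/
def faceProj (A : Set (Pbar P)) :
    AddMonoidAlgebra k (Pbar P → ℤ) →ₗ[k] AddMonoidAlgebra k (Pbar P → ℤ) where
  toFun x := .ofCoeff (x.coeff.filter (ConstOn A))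
  map_add' x y := by simp [Finsupp.filter_add]
  map_smul' c x := by simp [Finsupp.filter_smul]

theorem coeff_faceProj_of_constOn {A : Set (Pbar P)} {ψ : Pbar P → ℤ} (h : ConstOn A ψ)
    (x : AddMonoidAlgebra k (Pbar P → ℤ)) : (faceProj k P A x).coeff ψ = x.coeff ψ := by
  simp [faceProj, h]

theorem coeff_faceProj_of_not_constOn {A : Set (Pbar P)} {ψ : Pbar P → ℤ} (h : ¬ ConstOn A ψ)
    (x : AddMonoidAlgebra k (Pbar P → ℤ)) : (faceProj k P A x).coeff ψ = 0 := by
  simp [faceProj, h]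

theorem faceProj_hibiMono_of_constOn {A : Set (Pbar P)} {ψ : Pbar P → ℤ} (h : ConstOn A ψ) :
    faceProj k P A (hibiMono k P ψ) = hibiMono k P ψ := by
  classical simp [faceProj, hibiMono, Finsupp.filter_single_of_pos _ h]

theorem faceProj_hibiMono_of_not_constOn {A : Set (Pbar P)} {ψ : Pbar P → ℤ}
    (h : ¬ ConstOn A ψ) : faceProj k P A (hibiMono k P ψ) = 0 := by
  classical simp [faceProj, hibiMono, Finsupp.filter_single_of_neg _ h]

theorem ConnSubset.constOn_add_iff {Q : Type*} [PartialOrder Q] {A : Set Q} (hA : ConnSubset A)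
    {ψ χ : Q → ℤ} (hψ : Antitone ψ) (hχ : Antitone χ) :
    ConstOn A (ψ + χ) ↔ ConstOn A ψ ∧ ConstOn A χ := by
  refine ⟨fun h => ⟨hA.apply_eq ?_, hA.apply_eq ?_⟩, fun h a ha b hb => ?_⟩
  · intro a ha b hb hab
    have h1 := h a ha b hb
    have h2 := hψ hab
    have h3 := hχ hab
    simp only [Pi.add_apply] at h1
    linarith
  · intro a ha b hb hab
    have h1 := h a ha b hb
    have h2 := hψ hab
    have h3 := hχ hab
    simp only [Pi.add_apply] at h1
    linarith
  · simp only [Pi.add_apply, h.1 a ha b hb, h.2 a ha b hb]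

variable {k P} in
theorem faceProj_mul {A : Set (Pbar P)} (hA : ConnSubset A)
    {x y : AddMonoidAlgebra k (Pbar P → ℤ)} (hx : x ∈ hibiRing k P) (hy : y ∈ hibiRing k P) :
    faceProj k P A (x * y) = faceProj k P A x * faceProj k P A y := by
  rw [mem_hibiRing_iff_mem_span] at hx hy
  induction hx, hy using Submodule.span_induction₂ with
  | mem_mem _ _ hx hy =>
    obtain ⟨ψ, hψ, rfl⟩ := hx
    obtain ⟨χ, hχ, rfl⟩ := hy
    rw [hibiMono_mul]
    have hiff := hA.constOn_add_iff hψ.1 hχ.1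
    by_cases h1 : ConstOn A ψ
    · by_cases h2 : ConstOn A χ
      · rw [faceProj_hibiMono_of_constOn k P h1, faceProj_hibiMono_of_constOn k P h2,
          faceProj_hibiMono_of_constOn k P (hiff.2 ⟨h1, h2⟩), hibiMono_mul]
      · rw [faceProj_hibiMono_of_not_constOn k P h2,
          faceProj_hibiMono_of_not_constOn k P fun h => h2 (hiff.1 h).2, mul_zero]
    · rw [faceProj_hibiMono_of_not_constOn k P h1,
        faceProj_hibiMono_of_not_constOn k P fun h => h1 (hiff.1 h).1, zero_mul]
  | zero_left y hy => simp
  | zero_right x hx => simp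
  | add_left x y z _ _ _ h1 h2 => simp only [add_mul, map_add, h1, h2]
  | add_right x y z _ _ _ h1 h2 => simp only [mul_add, map_add, h1, h2]
  | smul_left r x y _ _ h => simp only [smul_mul_assoc, map_smul, h]
  | smul_right r x y _ _ h => simp only [mul_smul_comm, map_smul, h]

/-- The ring homomorphism from the Hibi ring onto the coordinate ring of the face `F_A`. -/
def faceHom {A : Set (Pbar P)} (hA : ConnSubset A) :
    hibiRing k P →+* AddMonoidAlgebra k (Pbar P → ℤ) where
  toFun x := faceProj k P A x
  map_one' := faceProj_hibiMono_of_constOn k P (ψ := 0) fun _ _ _ _ => rfl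
  map_mul' x y := faceProj_mul hA x.2 y.2
  map_zero' := map_zero _
  map_add' _ _ := map_add (faceProj k P A) _ _

variable {P} in
theorem coe_coneMono_pow {f : Pbar P → ℤ} (hf : InConeP P f) (n : ℕ) :
    ((coneMono k hf ^ n : hibiRing k P) : AddMonoidAlgebra k (Pbar P → ℤ)) =
      hibiMono k P (n • f) := by
  simp [coneMono, hibiMono]

variable [Fintype P]

variable {P} in
theorem coneMono_mem_hibiFacePrime {A : Set (Pbar P)} {ψ : Pbar P → ℤ} (hψ : InConeP P ψ)
    (h : ¬ ConstOn A ψ) : coneMono k hψ ∈ hibiFacePrime k P A :=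
  Ideal.subset_span ⟨ψ, hψ, h, rfl⟩

variable {k P} in
theorem exists_sub_faceProj_eq (A : Set (Pbar P)) {x : AddMonoidAlgebra k (Pbar P → ℤ)}
    (hx : x ∈ hibiRing k P) :
    ∃ y ∈ hibiFacePrime k P A, (y : AddMonoidAlgebra k (Pbar P → ℤ)) = x - faceProj k P A x := by
  rw [mem_hibiRing_iff_mem_span] at hx
  induction hx using Submodule.span_induction with
  | mem x hx =>
    obtain ⟨ψ, hψ, rfl⟩ := hx
    by_cases h : ConstOn A ψ
    · exact ⟨0, zero_mem _, by simp [faceProj_hibiMono_of_constOn k P h]⟩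
    · exact ⟨coneMono k hψ, coneMono_mem_hibiFacePrime k hψ h, by
        rw [faceProj_hibiMono_of_not_constOn k P h, sub_zero]; rfl⟩
  | zero => exact ⟨0, zero_mem _, by simp⟩
  | add x y _ _ hx hy =>
    obtain ⟨u, hu, hu'⟩ := hx
    obtain ⟨v, hv, hv'⟩ := hy
    refine ⟨u + v, add_mem hu hv, ?_⟩
    rw [Subalgebra.coe_add, hu', hv', map_add]
    abel
  | smul c x _ hx =>
    obtain ⟨u, hu, hu'⟩ := hx
    refine ⟨c • u, ?_, ?_⟩
    · rw [Algebra.smul_def]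
      exact Ideal.mul_mem_left _ _ hu
    · rw [Subalgebra.coe_smul, hu', map_smul, smul_sub]

theorem hibiFacePrime_eq_ker {A : Set (Pbar P)} (hA : ConnSubset A) :
    hibiFacePrime k P A = RingHom.ker (faceHom k P hA) := by
  refine le_antisymm (Ideal.span_le.2 ?_) fun x hx => ?_
  · rintro r ⟨ψ, -, h, hr⟩
    change faceProj k P A r = 0
    rw [hr, faceProj_hibiMono_of_not_constOn k P h]
  · obtain ⟨y, hy, hyx⟩ := exists_sub_faceProj_eq A x.2
    have h0 : faceProj k P A x = 0 := hx
    rw [h0, sub_zero] at hyx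
    rwa [← Subtype.ext hyx]

theorem hibiFacePrime_isPrime {A : Set (Pbar P)} (hA : ConnSubset A) :
    (hibiFacePrime k P A).IsPrime := by
  rw [hibiFacePrime_eq_ker k P hA]
  exact RingHom.ker_isPrime _

variable {k} in
theorem coneMono_mem_hibiFacePrime_iff {A : Set (Pbar P)} (hA : ConnSubset A)
    {ψ : Pbar P → ℤ} (hψ : InConeP P ψ) :
    coneMono k hψ ∈ hibiFacePrime k P A ↔ ¬ ConstOn A ψ := by
  refine ⟨fun h hc => ?_, coneMono_mem_hibiFacePrime k hψ⟩
  rw [hibiFacePrime_eq_ker k P hA] at h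
  have h0 : faceProj k P A (hibiMono k P ψ) = 0 := h
  rw [faceProj_hibiMono_of_constOn k P hc, hibiMono, AddMonoidAlgebra.single_eq_zero] at h0
  exact one_ne_zero h0

theorem exists_coeff_ne_zero_of_notMem_hibiFacePrime {A : Set (Pbar P)} (hA : ConnSubset A)
    {x : hibiRing k P} (hx : x ∉ hibiFacePrime k P A) :
    ∃ η : Pbar P → ℤ, ConstOn A η ∧ (x : AddMonoidAlgebra k (Pbar P → ℤ)).coeff η ≠ 0 := by
  by_contra! h
  refine hx ?_
  rw [hibiFacePrime_eq_ker k P hA]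
  change faceProj k P A x = 0
  ext η
  by_cases hη : ConstOn A η
  · rw [coeff_faceProj_of_constOn k P hη, h η hη]; simp
  · rw [coeff_faceProj_of_not_constOn k P hη]; simp

variable {P} in
theorem inConeP_of_covBy {ψ : Pbar P → ℤ} (h0 : ψ ⊤ = 0)
    (h : ∀ a b : Pbar P, a ⋖ b → ψ b ≤ ψ a) : InConeP P ψ :=
  ⟨antitone_of_covBy_le h, h0⟩

variable {P} in
/-- The monomial `χ^ψ` of an interior lattice point of the cone as an element of `ω`. -/
def omegaMono {ψ : Pbar P → ℤ} (h0 : ψ ⊤ = 0)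
    (h : ∀ a b : Pbar P, a ⋖ b → ψ b + 1 ≤ ψ a) : hibiOmega k P :=
  ⟨hibiMono k P ψ, Submodule.subset_span ⟨ψ, h0, h, rfl⟩⟩

variable {k P} in
/-- The exponents of the image of the monomial `χ^ψ` under a homomorphism `ω → R(P)`, shifted by
`-ψ`, translate the interior lattice points of the cone into the cone. -/
theorem inConeP_add_sub_of_coeff_ne_zero (φ : hibiOmega k P →ₗ[hibiRing k P] hibiRing k P)
    {ψ χ η : Pbar P → ℤ} (hψ0 : ψ ⊤ = 0) (hψ : ∀ a b : Pbar P, a ⋖ b → ψ b + 1 ≤ ψ a)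
    (hχ0 : χ ⊤ = 0) (hχ : ∀ a b : Pbar P, a ⋖ b → χ b + 1 ≤ χ a)
    (hη : (φ (omegaMono k hψ0 hψ) : AddMonoidAlgebra k (Pbar P → ℤ)).coeff η ≠ 0) :
    InConeP P (χ + η - ψ) := by
  have hψC : InConeP P ψ := inConeP_of_covBy hψ0 fun a b hab => by linarith [hψ a b hab]
  have hχC : InConeP P χ := inConeP_of_covBy hχ0 fun a b hab => by linarith [hχ a b hab]
  have h1 : coneMono k hχC • omegaMono k hψ0 hψ = coneMono k hψC • omegaMono k hχ0 hχ :=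
    Subtype.ext (mul_comm (hibiMono k P χ) (hibiMono k P ψ))
  have h2 := congrArg φ h1
  rw [map_smul, map_smul, smul_eq_mul, smul_eq_mul] at h2
  have h3 := congrArg (fun x : hibiRing k P =>
    (x : AddMonoidAlgebra k (Pbar P → ℤ)).coeff (χ + η)) h2
  simp only [Subalgebra.coe_mul, coneMono, hibiMono, AddMonoidAlgebra.coeff_single_mul_apply,
    one_mul] at h3
  rw [neg_add_cancel_left] at h3
  rw [h3] at hη
  have := inConeP_of_coeff_ne_zero (φ (omegaMono k hχ0 hχ)).2 hη
  rwa [neg_add_eq_sub] at this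

theorem hibiTrace_le_hibiFacePrime {A : Set (Pbar P)} (hA : CompleteSubset A)
    (hgr : ¬ IsGradedPoset A) : hibiTrace k P ≤ hibiFacePrime k P A := by
  refine Ideal.span_le.2 ?_
  rintro _ ⟨φ, ⟨x, hx⟩, rfl⟩
  change φ ⟨x, hx⟩ ∈ hibiFacePrime k P A
  induction hx using Submodule.span_induction with
  | mem x hx =>
    obtain ⟨ψ, hψ0, hψ, rfl⟩ := hx
    by_contra hmem
    obtain ⟨η, hηA, hη⟩ := exists_coeff_ne_zero_of_notMem_hibiFacePrime k P hA.2.1 hmem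
    refine hgr ⟨fun a => ψ a, fun a b hab => ?_⟩
    have hcov := hA.2.2.covBy_of_subtype_covBy hab
    obtain ⟨h, hanti, hab1⟩ := exists_strictAnti_eq_add_one_of_covBy hcov
    have hC := inConeP_add_sub_of_coeff_ne_zero (χ := fun x => h x - h ⊤) φ hψ0 hψ (sub_self _)
      (fun c d hcd => by
        have := hanti hcd.lt
        omega) hη
    have h1 := hC.1 hcov.le
    have h2 := hηA a a.2 b b.2
    have h3 := hψ a b hcov
    simp only [Pi.add_apply, Pi.sub_apply] at h1
    change ψ a = ψ b + 1
    omega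
  | zero => exact (map_zero φ).symm ▸ zero_mem _
  | add x y hx hy h1 h2 =>
    have := φ.map_add ⟨x, hx⟩ ⟨y, hy⟩
    exact this.symm ▸ add_mem h1 h2
  | smul r x hx h =>
    have := φ.map_smul r ⟨x, hx⟩
    exact this.symm ▸ Ideal.mul_mem_left _ r h

variable {k P} in
theorem hibiMono_mul_mem_hibiRing {ψ' : Pbar P → ℤ} (h0 : ψ' ⊤ = 0)
    (h : ∀ a b : Pbar P, a ⋖ b → ψ' b ≤ ψ' a + 1) {x : AddMonoidAlgebra k (Pbar P → ℤ)}
    (hx : x ∈ hibiOmega k P) : hibiMono k P ψ' * x ∈ hibiRing k P := by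
  induction hx using Submodule.span_induction with
  | mem x hx =>
    obtain ⟨ψ, hψ0, hψ, rfl⟩ := hx
    rw [hibiMono_mul]
    refine (coneMono k (inConeP_of_covBy (by simp [h0, hψ0]) fun a b hab => ?_)).2
    have h1 := h a b hab
    have h2 := hψ a b hab
    simp only [Pi.add_apply]
    linarith
  | zero => simp
  | add x y _ _ hx hy => rw [mul_add]; exact add_mem hx hy
  | smul r x _ hx =>
    rw [mul_smul_comm]
    exact mul_mem r.2 hx

variable {P} in
/-- Multiplication by the monomial `χ^ψ'` as a homomorphism `ω → R(P)`. -/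
def mulHibiMono {ψ' : Pbar P → ℤ} (h0 : ψ' ⊤ = 0)
    (h : ∀ a b : Pbar P, a ⋖ b → ψ' b ≤ ψ' a + 1) :
    hibiOmega k P →ₗ[hibiRing k P] hibiRing k P where
  toFun x := ⟨hibiMono k P ψ' * x, hibiMono_mul_mem_hibiRing h0 h x.2⟩
  map_add' _ _ := Subtype.ext (mul_add _ _ _)
  map_smul' r x := Subtype.ext (mul_left_comm (hibiMono k P ψ')
    (r : AddMonoidAlgebra k (Pbar P → ℤ)) (x : AddMonoidAlgebra k (Pbar P → ℤ)))

/-- A power of `χ^f` lies in the trace of `ω` if the components of the fibres of `f` are graded. -/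
theorem exists_pow_mem_hibiTrace {f : Pbar P → ℤ} (hf : InConeP P f)
    (h : ∀ a, IsGradedPoset ↥{b | (fibreSetoid f).r a b}) :
    ∃ n : ℕ, coneMono k hf ^ n ∈ hibiTrace k P := by
  obtain ⟨n, ψ, ψ', hψ0, hψ'0, hψ, hψ', hsum⟩ :=
    exists_add_eq_nsmul_of_graded_components hf.1 hf.2 h
  refine ⟨n, Ideal.subset_span ⟨mulHibiMono k hψ'0 hψ', omegaMono k hψ0 hψ, Subtype.ext ?_⟩⟩
  rw [coe_coneMono_pow, ← hsum, add_comm]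
  exact hibiMono_mul k P ψ' ψ

variable {k P} in
/-- Among the lattice points whose monomials avoid a prime there is one that is as injective as
possible on comparable pairs. -/
theorem exists_generic_notMem {q : Ideal (hibiRing k P)} (hq : q.IsPrime) :
    ∃ (f : Pbar P → ℤ) (hf : InConeP P f), coneMono k hf ∉ q ∧
      ∀ (χ : Pbar P → ℤ) (hχ : InConeP P χ), coneMono k hχ ∉ q →
        ∀ a b, a ≤ b → f a = f b → χ a = χ b := by
  let pairs : (Pbar P → ℤ) → Set (Pbar P × Pbar P) := fun f => {p | p.1 ≤ p.2 ∧ f p.1 = f p.2}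
  obtain ⟨s, ⟨f, hf, hfq, rfl⟩, hmin⟩ := exists_minimal_of_wellFoundedLT
    (fun s : Set (Pbar P × Pbar P) => ∃ (f : Pbar P → ℤ) (hf : InConeP P f),
      coneMono k hf ∉ q ∧ pairs f = s)
    ⟨_, 0, inConeP_zero P, (Ideal.ne_top_iff_one q).1 hq.ne_top, rfl⟩
  refine ⟨f, hf, hfq, fun χ hχ hχq a b hab hfab => ?_⟩
  have hle : pairs (f + χ) ≤ pairs f := by
    rintro ⟨c, d⟩ ⟨hcd, h⟩
    refine ⟨hcd, ?_⟩
    have h1 := hf.1 hcd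
    have h2 := hχ.1 hcd
    simp only [Pi.add_apply] at h ⊢
    linarith
  have hmem : (a, b) ∈ pairs (f + χ) :=
    hmin ⟨f + χ, hf.add hχ, fun hc => (hq.mem_or_mem (coneMono_mul k hf hχ ▸ hc)).elim hfq hχq,
      rfl⟩ hle ⟨hab, hfab⟩
  have h := hmem.2
  simp only [Pi.add_apply] at h
  linarith

variable {k P} in
/-- Every prime over the trace contains the prime of a minimal complete non-graded subset. -/
theorem exists_hibiFacePrime_le {q : Ideal (hibiRing k P)} (hq : q.IsPrime)
    (hle : hibiTrace k P ≤ q) :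
    ∃ B : Set (Pbar P), Minimal (fun C : Set (Pbar P) => CompleteSubset C ∧ ¬ IsGradedPoset C) B ∧
      hibiFacePrime k P B ≤ q := by
  obtain ⟨f, hf, hfq, hgen⟩ := exists_generic_notMem hq
  obtain ⟨a, ha⟩ : ∃ a, ¬ IsGradedPoset ↥{b | (fibreSetoid f).r a b} := by
    by_contra! h
    obtain ⟨n, hn⟩ := exists_pow_mem_hibiTrace k P hf h
    exact hfq (hq.mem_of_pow_mem n (hle hn))
  obtain ⟨B, hBA, hB⟩ := exists_minimal_le_of_wellFoundedLT
    (fun C : Set (Pbar P) => CompleteSubset C ∧ ¬ IsGradedPoset C) _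
    ⟨hf.1.completeSubset_fibre_component a, ha⟩
  refine ⟨B, hB, Ideal.span_le.2 ?_⟩
  rintro r ⟨χ, hχ, hχB, hr⟩
  obtain rfl : r = coneMono k hχ := Subtype.ext hr
  by_contra hχq
  refine hχB (hB.1.1.2.1.apply_eq fun x hx y hy hxy => hgen χ hχ hχq x y hxy ?_)
  exact (apply_eq_of_fibreSetoid (hBA hx)).symm.trans (apply_eq_of_fibreSetoid (hBA hy))

variable {k P} in
theorem subset_of_hibiFacePrime_le {A B : Set (Pbar P)} (hA : CompleteSubset A)
    (hB : ¬ IsGradedPoset B) (h : hibiFacePrime k P B ≤ hibiFacePrime k P A) : B ⊆ A := by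
  classical
  intro x hx
  by_contra hxA
  obtain ⟨y, hy, hxy⟩ : ∃ y ∈ B, x ≠ y := by
    by_contra! h
    have : Subsingleton B := ⟨fun u v => Subtype.ext ((h u u.2).symm.trans (h v v.2))⟩
    exact hB isGradedPoset_of_subsingleton
  obtain ⟨D, hD, hDA, hDxy⟩ := hA.2.2.exists_isLowerSet_separating hxA hxy
  have hanti : Antitone fun z => if z ∈ D then (1 : ℤ) else 0 := by
    intro u v huv
    by_cases hv : v ∈ D
    · simp [hv, hD huv hv]
    · simp only [hv, if_false]
      split_ifs <;> norm_num
  have htop : (⊤ : Pbar P) ∉ D := fun ht =>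
    hDxy ⟨fun _ => hD le_top ht, fun _ => hD le_top ht⟩
  have hC : InConeP P fun z => if z ∈ D then (1 : ℤ) else 0 := ⟨hanti, if_neg htop⟩
  refine (coneMono_mem_hibiFacePrime_iff P hA.2.1 hC).1
    (h (coneMono_mem_hibiFacePrime k hC fun hconst => ?_)) fun a ha b hb => ?_
  · have := hconst x hx y hy
    by_cases h1 : x ∈ D <;> by_cases h2 : y ∈ D <;> simp_all
  · have : a ∈ D ↔ b ∈ D := ⟨hDA a ha b hb, hDA b hb a ha⟩
    simp only [this]

variable {k P} in
theorem eq_of_hibiFacePrime_le {A B : Set (Pbar P)}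
    (hA : Minimal (fun C : Set (Pbar P) => CompleteSubset C ∧ ¬ IsGradedPoset C) A)
    (hB : CompleteSubset B ∧ ¬ IsGradedPoset B)
    (h : hibiFacePrime k P B ≤ hibiFacePrime k P A) : A = B :=
  (hA.eq_of_le hB (subset_of_hibiFacePrime_le hA.1.1 hB.2 h)).symm

end Algebra

/-- The minimal primes of the Hibi ring `R(P)` lying over `tr(ω)` are exactly
the ideals `p_{F_A}` for `A` minimal among the complete non-graded subsets of `P̄`, and
`A ↦ p_{F_A}` is a bijection between these minimal subsets and the minimal primes over
`tr(ω)` (equivalently, the maximal components of the non-Gorenstein locus). -/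
theorem hibi_minimal_primes_over_trace
    (k : Type) [Field k] [IsAlgClosed k] [CharZero k]
    (P : Type) [Fintype P] [PartialOrder P] :
    (∀ A : Set (Pbar P),
        Minimal (fun B : Set (Pbar P) => CompleteSubset B ∧ ¬ IsGradedPoset ↥B) A →
        hibiFacePrime k P A ∈ (hibiTrace k P).minimalPrimes) ∧
    (∀ q ∈ (hibiTrace k P).minimalPrimes, ∃ A : Set (Pbar P),
        Minimal (fun B : Set (Pbar P) => CompleteSubset B ∧ ¬ IsGradedPoset ↥B) A ∧
        q = hibiFacePrime k P A) ∧
    (∀ A B : Set (Pbar P),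
        Minimal (fun C : Set (Pbar P) => CompleteSubset C ∧ ¬ IsGradedPoset ↥C) A →
        Minimal (fun C : Set (Pbar P) => CompleteSubset C ∧ ¬ IsGradedPoset ↥C) B →
        hibiFacePrime k P A = hibiFacePrime k P B → A = B) := by
  refine ⟨fun A hA => ⟨⟨hibiFacePrime_isPrime k P hA.1.1.2.1,
    hibiTrace_le_hibiFacePrime k P hA.1.1 hA.1.2⟩, fun q hq hle => ?_⟩, fun q hq => ?_,
    fun A B hA hB h => eq_of_hibiFacePrime_le hA hB.1 h.ge⟩
  · obtain ⟨B, hB, hBq⟩ := exists_hibiFacePrime_le hq.1 hq.2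
    obtain rfl := eq_of_hibiFacePrime_le hA hB.1 (hBq.trans hle)
    exact hBq
  · obtain ⟨B, hB, hBq⟩ := exists_hibiFacePrime_le hq.1.1 hq.1.2
    exact ⟨B, hB, le_antisymm (hq.2 ⟨hibiFacePrime_isPrime k P hB.1.1.2.1,
      hibiTrace_le_hibiFacePrime k P hB.1.1 hB.1.2⟩ hBq) hBq⟩
end
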